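/- arXiv:1812.09526 — 2 statements merged into one kernel-verified Lean document; each statement's English description precedes it below -/
import Mathlib

section
/- Let m ≥ 1 and k ≥ 2, and let H=(V,E) be the m-fold 2k-cycle. Let h be an edge-dominated E-polymatroid on V and θ ≥ 0 with h(I_1) ≤ θ. Then for every i with 2 ≤ i ≤ 2k−1, h(I_1 ∪ I_i ∪ I_{i+1}) ≤ θ + m. -/
/-- Vertices of the `m`-fold `2k`-cycle: pairs `(i, j)` with `i` a cyclic group index and
`j ∈ [m]`; the vertex `(i, j)` is `I_i^j`. -/
abbrev CycVtx (m k : ℕ) := ZMod (2 * k) × Fin m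

/-- The vertex group `I_i`. -/
def cycGroup (m k : ℕ) (i : ZMod (2 * k)) : Finset (CycVtx m k) :=
  Finset.univ.image (fun j : Fin m => (i, j))

/-- The edges of the `m`-fold `2k`-cycle: all pairs `{I_i^j, I_{i+1}^{j'}}`
(complete bipartite graphs between cyclically consecutive groups). -/
def cycEdges (m k : ℕ) : Set (Finset (CycVtx m k)) :=
  { e | ∃ (i : ZMod (2 * k)) (j j' : Fin m), e = {(i, j), (i + 1, j')} }

/-- An `E`-polymatroid (with `E` a collection of subsets of `V`). -/
def IsEPolymatroid {V : Type} [DecidableEq V]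
    (E : Set (Finset V)) (h : Finset V → ℝ) : Prop :=
  (∀ S : Finset V, 0 ≤ h S) ∧ h ∅ = 0 ∧
    (∀ X Y : Finset V, X ⊆ Y → h X ≤ h Y) ∧
    (∀ X Y : Finset V, (∃ S ∈ E, X ∩ Y ⊆ S) → h (X ∪ Y) + h (X ∩ Y) ≤ h X + h Y)

/-- Edge-dominated: at most `1` on every edge. -/
def EdgeDominated {V : Type} [DecidableEq V]
    (E : Set (Finset V)) (h : Finset V → ℝ) : Prop :=
  ∀ S ∈ E, h S ≤ 1

/-- An `E`-polymatroid with `E` nonempty is subadditive. -/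
theorem IsEPolymatroid.union_le {V : Type} [DecidableEq V] {E : Set (Finset V)}
    {h : Finset V → ℝ} (hEP : IsEPolymatroid E h) (hE : E.Nonempty) (X Y : Finset V) :
    h (X ∪ Y) ≤ h X + h Y := by
  obtain ⟨-, h0, hmono, hsub⟩ := hEP
  obtain ⟨S, hS⟩ := hE
  have hdisj : X ∩ (Y \ X) = ∅ := Finset.inter_sdiff_self X Y
  have hle := hsub X (Y \ X) ⟨S, hS, by simp [hdisj]⟩
  rw [hdisj, h0, Finset.union_sdiff_self_eq_union] at hle
  linarith [hmono (Y \ X) Y Finset.sdiff_subset]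

/-- An `E`-polymatroid with `E` nonempty is subadditive over finite unions. -/
theorem IsEPolymatroid.biUnion_le {V ι : Type} [DecidableEq V] {E : Set (Finset V)}
    {h : Finset V → ℝ} (hEP : IsEPolymatroid E h) (hE : E.Nonempty)
    (s : Finset ι) (f : ι → Finset V) :
    h (s.biUnion f) ≤ ∑ j ∈ s, h (f j) := by
  classical
  induction s using Finset.induction_on with
  | empty => simp [hEP.2.1]
  | insert a s ha ih =>
    rw [Finset.biUnion_insert, Finset.sum_insert ha]
    linarith [hEP.union_le hE (f a) (s.biUnion f)]

/-- Two consecutive groups are covered by `m` edges. -/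
theorem cycGroup_union_succ (m k : ℕ) (i : ZMod (2 * k)) :
    cycGroup m k i ∪ cycGroup m k (i + 1) =
      Finset.univ.biUnion fun j : Fin m => {(i, j), (i + 1, j)} := by
  ext ⟨a, b⟩
  simp only [cycGroup, Finset.mem_union, Finset.mem_image, Finset.mem_univ, true_and,
    Finset.mem_biUnion, Finset.mem_insert, Finset.mem_singleton, Prod.mk.injEq]
  grind

/-- Case 1 bound for the `m`-fold `2k`-cycle: if `h(I_1) ≤ θ` then
`h(I_1 ∪ I_i ∪ I_{i+1}) ≤ θ + m` for every `2 ≤ i ≤ 2k − 1`. -/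
theorem mfold_cycle_case_one_bound
    (m k : ℕ) (hm : 1 ≤ m) (hk : 2 ≤ k)
    (h : Finset (CycVtx m k) → ℝ)
    (hEP : IsEPolymatroid (cycEdges m k) h) (hED : EdgeDominated (cycEdges m k) h)
    (θ : ℝ) (hθ : 0 ≤ θ) (h1 : h (cycGroup m k 1) ≤ θ)
    (i : ℕ) (hi2 : 2 ≤ i) (hi : i ≤ 2 * k - 1) :
    h (cycGroup m k 1 ∪ cycGroup m k (i : ZMod (2 * k)) ∪
        cycGroup m k ((i : ZMod (2 * k)) + 1)) ≤ θ + (m : ℝ) := by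
  have hE : (cycEdges m k).Nonempty := ⟨_, 0, ⟨0, hm⟩, ⟨0, hm⟩, rfl⟩
  have hpair : h (cycGroup m k (i : ZMod (2 * k)) ∪ cycGroup m k ((i : ZMod (2 * k)) + 1)) ≤ m := by
    rw [cycGroup_union_succ]
    refine (hEP.biUnion_le hE _ _).trans ?_
    refine (Finset.sum_le_sum fun j _ => hED _ ⟨i, j, j, rfl⟩).trans ?_
    simp
  rw [Finset.union_assoc]
  exact (hEP.union_le hE _ _).trans (add_le_add h1 hpair)
end

section
/- Let m, k ≥ 1 and let H=(V,E) be the m-fold 2k-cycle. Let h be an edge-dominated E-polymatroid on V and θ ≥ 0 such that h(I_i) ≥ θ for every i ∈ {2,…,k}. Then h(I_1 ∪ I_2 ∪ ⋯ ∪ I_{k+1}) ≤ km − (k−1)θ. -/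
/-- An `E`-polymatroid is subadditive on pairwise disjoint finite families. -/
theorem IsEPolymatroid.biUnion_le_sum {V ι : Type} [DecidableEq V] [DecidableEq ι]
    {E : Set (Finset V)} {h : Finset V → ℝ} (hEP : IsEPolymatroid E h) (hE : E.Nonempty)
    (f : ι → Finset V) (s : Finset ι) (hf : ∀ a b, a ≠ b → Disjoint (f a) (f b)) :
    h (s.biUnion f) ≤ ∑ a ∈ s, h (f a) := by
  obtain ⟨-, h0, -, hsub⟩ := hEP
  induction s using Finset.induction_on with
  | empty => simp [h0]
  | insert a s ha ih =>
    have hd : f a ∩ s.biUnion f = ∅ := by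
      rw [← Finset.disjoint_iff_inter_eq_empty, Finset.disjoint_biUnion_right]
      intro b hb
      exact hf a b (by rintro rfl; exact ha hb)
    obtain ⟨S, hS⟩ := hE
    have key := hsub (f a) (s.biUnion f) ⟨S, hS, by simp [hd]⟩
    rw [hd, h0] at key
    rw [Finset.biUnion_insert, Finset.sum_insert ha]
    linarith

/-- The path `I_1^j, …, I_{n+1}^j`. -/
def cycPath (m k n : ℕ) (j : Fin m) : Finset (CycVtx m k) :=
  (Finset.Icc 1 (n + 1)).image (fun i : ℕ => ((i : ZMod (2 * k)), j))

theorem cycPath_succ (m k n : ℕ) (j : Fin m) :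
    cycPath m k (n + 1) j =
      cycPath m k n j ∪ {(((n + 1 : ℕ) : ZMod (2 * k)), j), (((n + 1 : ℕ) : ZMod (2 * k)) + 1, j)} := by
  ext x
  simp only [cycPath, Finset.mem_image, Finset.mem_union, Finset.mem_Icc, Finset.mem_insert,
    Finset.mem_singleton]
  constructor
  · rintro ⟨i, ⟨h1, h2⟩, rfl⟩
    rcases Nat.lt_or_ge (n + 1) i with hi | hi
    · obtain rfl : i = n + 1 + 1 := by omega
      right; right; push_cast; rfl
    · exact Or.inl ⟨i, ⟨h1, hi⟩, rfl⟩
  · rintro (⟨i, ⟨h1, h2⟩, rfl⟩ | rfl | rfl)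
    · exact ⟨i, ⟨h1, by omega⟩, rfl⟩
    · exact ⟨n + 1, ⟨by omega, by omega⟩, rfl⟩
    · exact ⟨n + 1 + 1, ⟨by omega, le_rfl⟩, by push_cast; rfl⟩

theorem cycPath_inter_edge {m k n : ℕ} (hn : n + 1 ≤ k) (j : Fin m) :
    cycPath m k n j ∩ {(((n + 1 : ℕ) : ZMod (2 * k)), j), (((n + 1 : ℕ) : ZMod (2 * k)) + 1, j)} =
      {(((n + 1 : ℕ) : ZMod (2 * k)), j)} := by
  ext x
  simp only [cycPath, Finset.mem_image, Finset.mem_inter, Finset.mem_Icc, Finset.mem_insert,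
    Finset.mem_singleton]
  constructor
  · rintro ⟨⟨i, ⟨h1, h2⟩, rfl⟩, hx | hx⟩
    · exact hx
    · exfalso
      have hc : ((i : ℕ) : ZMod (2 * k)) = ((n + 1 + 1 : ℕ) : ZMod (2 * k)) := by
        rw [Nat.cast_succ (n + 1)]
        exact congrArg Prod.fst hx
      rw [ZMod.natCast_eq_natCast_iff, Nat.modEq_iff_dvd' (by omega)] at hc
      have := Nat.le_of_dvd (by omega) hc
      omega
  · rintro rfl
    exact ⟨⟨n + 1, ⟨by omega, le_rfl⟩, rfl⟩, Or.inl rfl⟩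

theorem cycPath_add_sum_le {m k : ℕ} {h : Finset (CycVtx m k) → ℝ}
    (hEP : IsEPolymatroid (cycEdges m k) h) (hED : EdgeDominated (cycEdges m k) h)
    (j : Fin m) (n : ℕ) (hn : 1 ≤ n) (hnk : n ≤ k) :
    h (cycPath m k n j) + ∑ i ∈ Finset.Icc 2 n, h {((i : ZMod (2 * k)), j)} ≤ n := by
  induction n, hn using Nat.le_induction with
  | base =>
    have he : cycPath m k 1 j = {((1 : ZMod (2 * k)), j), (1 + 1, j)} := by
      rw [cycPath_succ]
      simp [cycPath]
    simpa [he] using hED _ ⟨1, j, j, rfl⟩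
  | succ n hn ih =>
    have ih := ih (by omega)
    have hedge : ({(((n + 1 : ℕ) : ZMod (2 * k)), j), (((n + 1 : ℕ) : ZMod (2 * k)) + 1, j)} :
        Finset (CycVtx m k)) ∈ cycEdges m k := ⟨_, j, j, rfl⟩
    have key := hEP.2.2.2 (cycPath m k n j) _ ⟨_, hedge, Finset.inter_subset_right⟩
    rw [← cycPath_succ, cycPath_inter_edge hnk] at key
    have hle := hED _ hedge
    rw [Finset.sum_Icc_succ_top (by omega)]
    push_cast at *
    linarith

/-- Case 2 bound for the `m`-fold `2k`-cycle: if `h(I_i) ≥ θ` for `2 ≤ i ≤ k`, then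
`h(I_1 ∪ ⋯ ∪ I_{k+1}) ≤ km − (k−1)θ`. -/
theorem mfold_cycle_case_two_bound
    (m k : ℕ) (hm : 1 ≤ m) (hk : 1 ≤ k)
    (h : Finset (CycVtx m k) → ℝ)
    (hEP : IsEPolymatroid (cycEdges m k) h) (hED : EdgeDominated (cycEdges m k) h)
    (θ : ℝ) (hθ : 0 ≤ θ)
    (hlow : ∀ i : ℕ, 2 ≤ i → i ≤ k → θ ≤ h (cycGroup m k (i : ZMod (2 * k)))) :
    h ((Finset.Icc 1 (k + 1)).biUnion (fun i : ℕ => cycGroup m k (i : ZMod (2 * k))))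
      ≤ (k : ℝ) * (m : ℝ) - ((k : ℝ) - 1) * θ := by
  have hE : (cycEdges m k).Nonempty := ⟨_, 0, ⟨0, hm⟩, ⟨0, hm⟩, rfl⟩
  have hunion : (Finset.Icc 1 (k + 1)).biUnion (fun i : ℕ => cycGroup m k (i : ZMod (2 * k))) =
      Finset.univ.biUnion (cycPath m k k) := by
    ext ⟨a, b⟩
    simp [cycGroup, cycPath]
  have hpaths := hEP.biUnion_le_sum hE (cycPath m k k) Finset.univ (by
    intro a b hab
    rw [Finset.disjoint_left]
    intro x hx hy
    simp only [cycPath, Finset.mem_image] at hx hy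
    obtain ⟨i, -, rfl⟩ := hx
    obtain ⟨i', -, hi'⟩ := hy
    exact hab (congrArg Prod.snd hi').symm)
  have hgroup : ∀ i ∈ Finset.Icc 2 k, θ ≤ ∑ j : Fin m, h {((i : ZMod (2 * k)), j)} := by
    intro i hi
    rw [Finset.mem_Icc] at hi
    refine (hlow i hi.1 hi.2).trans ?_
    have := hEP.biUnion_le_sum hE
      (fun j : Fin m => ({((i : ZMod (2 * k)), j)} : Finset (CycVtx m k))) Finset.univ
      (by intro a b hab; simpa using hab)
    rwa [Finset.biUnion_singleton] at this
  have hpath := Finset.sum_le_sum fun j (_ : j ∈ (Finset.univ : Finset (Fin m))) =>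
    cycPath_add_sum_le hEP hED j k hk le_rfl
  rw [Finset.sum_add_distrib, Finset.sum_comm] at hpath
  have hθsum := Finset.sum_le_sum hgroup
  simp only [Finset.sum_const, Nat.card_Icc, nsmul_eq_mul, Finset.card_univ,
    Fintype.card_fin] at hpath hθsum
  have hcast : ((k + 1 - 2 : ℕ) : ℝ) = (k : ℝ) - 1 := by
    rw [show k + 1 - 2 = k - 1 by omega, Nat.cast_sub hk, Nat.cast_one]
  rw [hcast] at hθsum
  rw [hunion]
  linarith
end
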